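/- Let R be a field, 𝒜 an R-linear category, and c an object of 𝒜 such that End_𝒜(c) is finite-dimensional over R. Then for every simple R-linear representation S of 𝒜, the evaluation S(c) is finite-dimensional over R, with dim_R S(c) ≤ dim_R End_𝒜(c). -/

import Mathlib

open CategoryTheory

universe t w v u

variable {R : Type w} [Field R]
variable {A : Type u} [Category.{v} A] [Preadditive A] [Linear R A]

/-- An `R`-linear representation of the `R`-linear category `A` is an additive `R`-linear
functor `A ⥤ ModuleCat R`. -/
def IsLinearRep (M : A ⥤ ModuleCat.{t} R) : Prop :=
  ∃ _ : M.Additive, M.Linear R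

/-- A subrepresentation of a representation `M : A ⥤ ModuleCat R`. -/
structure SubRep (M : A ⥤ ModuleCat.{t} R) where
  carrier : ∀ x : A, Submodule R (M.obj x)
  map_mem : ∀ {x y : A} (f : x ⟶ y), ∀ m ∈ carrier x, M.map f m ∈ carrier y

/-- A representation is simple if it is nonzero and its only subrepresentations are
`0` and itself. -/
def IsSimpleRep (M : A ⥤ ModuleCat.{t} R) : Prop :=
  (∃ (x : A) (m : M.obj x), m ≠ 0) ∧
    ∀ N : SubRep M, (∀ x : A, N.carrier x = ⊥) ∨ (∀ x : A, N.carrier x = ⊤)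

/-- The Yoneda map `f ↦ S(f)(m)` attached to an element `m` of `S(c)`. -/
def evalMap (S : A ⥤ ModuleCat.{t} R) [S.Additive] [S.Linear R] {c : A} (m : S.obj c) (x : A) :
    (c ⟶ x) →ₗ[R] S.obj x where
  toFun f := S.map f m
  map_add' f g := by simp [S.map_add]
  map_smul' r f := by simp [S.map_smul]

/-- The subrepresentation generated by an element `m` of `S(c)`. -/
def SubRep.generated (S : A ⥤ ModuleCat.{t} R) [S.Additive] [S.Linear R] {c : A} (m : S.obj c) :
    SubRep S where
  carrier x := LinearMap.range (evalMap S m x)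
  map_mem := by
    rintro x y g _ ⟨f, rfl⟩
    exact ⟨f ≫ g, by simp [evalMap]⟩

lemma mem_generated_self (S : A ⥤ ModuleCat.{t} R) [S.Additive] [S.Linear R] {c : A}
    (m : S.obj c) : m ∈ (SubRep.generated S m).carrier c :=
  ⟨𝟙 c, by simp [evalMap]⟩

lemma evalMap_surjective_of_simple (S : A ⥤ ModuleCat.{t} R) [S.Additive] [S.Linear R]
    (hS : IsSimpleRep S) {c : A} (m : S.obj c) (hm : m ≠ 0) (x : A) :
    Function.Surjective (evalMap S m x) := by
  rcases hS.2 (SubRep.generated S m) with h | h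
  · have hmem := mem_generated_self S m
    rw [h c, Submodule.mem_bot] at hmem
    exact absurd hmem hm
  · exact LinearMap.range_eq_top.mp (h x)

/-- If `R` is a field and `End_𝒜(c)` is finite dimensional over `R`, then every simple
`R`-linear representation `S` of `𝒜` has `S(c)` finite dimensional, with
`dim_R S(c) ≤ dim_R End_𝒜(c)`. -/
theorem finrank_eval_le_of_simple (c : A) [FiniteDimensional R (c ⟶ c)]
    (S : A ⥤ ModuleCat.{t} R) (hSl : IsLinearRep S) (hS : IsSimpleRep S) :
    FiniteDimensional R (S.obj c) ∧
      Module.finrank R (S.obj c) ≤ Module.finrank R (c ⟶ c) := by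
  obtain ⟨_, _⟩ := hSl
  rcases subsingleton_or_nontrivial (S.obj c) with _ | _
  · exact ⟨inferInstance, by rw [Module.finrank_zero_of_subsingleton]; exact Nat.zero_le _⟩
  · obtain ⟨m, hm⟩ := exists_ne (0 : S.obj c)
    have hsurj := evalMap_surjective_of_simple S hS m hm c
    exact ⟨Module.Finite.of_surjective _ hsurj, LinearMap.finrank_le_finrank_of_surjective hsurj⟩
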